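/- arXiv:0907.1350 — 4 statements merged into one kernel-verified Lean document; each statement's English description precedes it below -/
import Mathlib

section
/- Let p be a prime, q = p^a, K = 𝔽_q((u)), and let Z denote the centre of SL₂(K). Let X be a finite subgroup of SL₂(K) such that q+1 divides the order of the image of X in the quotient group SL₂(K)/Z. Then Z ≤ X, and there exists an injective group homomorphism from X into SL₂(𝔽_q). -/
open Matrix

section Lattice

variable {n R K : Type*} [Fintype n] [DecidableEq n] [CommRing R] [Field K] [Algebra R K]

/-- The `R`-lattice in `n → K` spanned by the columns of all the matrices `ρ g`. -/
def columnLattice (R : Type*) [CommRing R] [Algebra R K] {G : Type*} [Group G]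
    (ρ : G →* Matrix.SpecialLinearGroup n K) : Submodule R (n → K) :=
  Submodule.span R (Set.range fun x : G × n ↦ (ρ x.1 : Matrix n n K) *ᵥ Pi.single x.2 1)

lemma columnLattice_isLattice {G : Type*} [Group G] [Finite G]
    (ρ : G →* Matrix.SpecialLinearGroup n K) : (columnLattice R ρ).IsLattice K where
  fg := Submodule.fg_span (Set.finite_range _)
  span_eq_top := by
    rw [columnLattice, Submodule.span_span_of_tower, eq_top_iff, ← (Pi.basisFun K n).span_eq]
    refine Submodule.span_mono ?_
    rintro _ ⟨i, rfl⟩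
    exact ⟨(1, i), by
      simp only [map_one, Matrix.SpecialLinearGroup.coe_one, one_mulVec, Pi.basisFun_apply]⟩

lemma mulVec_mem_columnLattice {G : Type*} [Group G]
    (ρ : G →* Matrix.SpecialLinearGroup n K) (g : G) {v : n → K} (hv : v ∈ columnLattice R ρ) : (ρ g : Matrix n n K) *ᵥ v ∈ columnLattice R ρ := by
  induction hv using Submodule.span_induction with
  | mem x hx =>
    obtain ⟨⟨h, i⟩, rfl⟩ := hx
    refine Submodule.subset_span ⟨(g * h, i), ?_⟩
    simp only [map_mul, Matrix.SpecialLinearGroup.coe_mul, mulVec_mulVec]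
  | zero => simp
  | add x y _ _ hx hy => simpa only [mulVec_add] using add_mem hx hy
  | smul a x _ hx => simpa only [mulVec_smul] using Submodule.smul_mem _ a hx

/-- A finite group of matrices of determinant one over the fraction field of a principal ideal
domain `R` embeds into the special linear group over `R`. -/
theorem exists_injective_hom_specialLinearGroup [IsDomain R] [IsPrincipalIdealRing R]
    [IsFractionRing R K] {G : Type*} [Group G] [Finite G]
    (ρ : G →* Matrix.SpecialLinearGroup n K) (hρ : Function.Injective ρ) :
    ∃ φ : G →* Matrix.SpecialLinearGroup n R, Function.Injective φ := by
  have := columnLattice_isLattice (R := R) ρ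
  let M := columnLattice R ρ
  have hM : Module.rank R M = Fintype.card n := Submodule.IsLattice.rank_of_pi K M
  let c := Module.Free.chooseBasis R M
  have hc : Fintype.card (Module.Free.ChooseBasisIndex R M) = Fintype.card n := by
    rw [rank_eq_card_basis c] at hM
    exact_mod_cast hM
  let b := c.reindex (Fintype.equivOfCardEq hc)
  let bK := b.extendOfIsLattice K
  let T : G → M →ₗ[R] M := fun g ↦
    ((Matrix.toLin' (ρ g : Matrix n n K)).restrictScalars R).restrict
      (fun v hv ↦ mulVec_mem_columnLattice ρ g hv)
  have coe_T : ∀ g v, (T g v : n → K) = (ρ g : Matrix n n K) *ᵥ v := fun g v ↦ rfl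
  have hT : ∀ g h, T (g * h) = T g * T h := fun g h ↦ by
    ext1 v
    apply Subtype.ext
    simp [coe_T, mulVec_mulVec]
  have hmap : ∀ g, (algebraMap R K).mapMatrix (LinearMap.toMatrix b b (T g)) =
      LinearMap.toMatrix bK bK (Matrix.toLin' (ρ g : Matrix n n K)) := fun g ↦ by
    apply (Matrix.toLin bK bK).injective
    rw [Matrix.toLin_toMatrix]
    refine bK.ext fun j ↦ ?_
    have h1 : T g (b j) = ∑ i, LinearMap.toMatrix b b (T g) i j • b i := by
      conv_lhs => rw [← Matrix.toLin_toMatrix b b (T g), Matrix.toLin_self]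
    have h2 := congrArg (Subtype.val) h1
    rw [Matrix.toLin_self]
    simp only [AddSubmonoidClass.coe_finsetSum, Submodule.coe_smul] at h2
    rw [coe_T] at h2
    simpa [bK] using h2.symm
  have hdet : ∀ g, (LinearMap.toMatrix b b (T g)).det = 1 := fun g ↦ by
    apply IsFractionRing.injective R K
    rw [RingHom.map_det, hmap, LinearMap.det_toMatrix, LinearMap.det_toLin', (ρ g).det_coe, map_one]
  refine ⟨MonoidHom.mk' (fun g ↦ ⟨LinearMap.toMatrix b b (T g), hdet g⟩) fun g h ↦ ?_,
    fun g h hgh ↦ hρ ?_⟩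
  · apply Subtype.ext
    exact (congrArg _ (hT g h)).trans (LinearMap.toMatrix_mul b (T g) (T h))
  · have h1 : LinearMap.toMatrix b b (T g) = LinearMap.toMatrix b b (T h) :=
      congrArg Subtype.val hgh
    apply Subtype.ext
    apply Matrix.toLin'.injective
    apply (LinearMap.toMatrix bK bK).injective
    rw [← hmap, ← hmap, h1]

end Lattice

/-- An element of finite order congruent to one modulo `u` has `p`-power order, when `p` is the
characteristic and the `u`-adic topology is separated. -/
theorem exists_pow_char_pow_eq_one {O A : Type*} [CommRing O] [Ring A] [Algebra O A]
    (p : ℕ) [Fact p.Prime] [CharP A p] {u : O}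
    (hu : ∀ c : A, (∀ k : ℕ, ∃ b, c = u ^ k • b) → c = 0)
    {x b : A} (hx : IsOfFinOrder x) (hxb : x = 1 + u • b) : ∃ k : ℕ, x ^ p ^ k = 1 := by
  have : Finite (Submonoid.powers x) := hx.finite_powers
  obtain ⟨y, hy⟩ := Finite.exists_infinite_fiber
    (fun k : ℕ ↦ (⟨x ^ p ^ k, p ^ k, rfl⟩ : Submonoid.powers x))
  rw [Set.infinite_coe_iff] at hy
  have key : ∀ k : ℕ, x ^ p ^ k = 1 + u ^ p ^ k • b ^ p ^ k := fun k ↦ by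
    rw [hxb, add_pow_char_pow_of_commute _ _ (Commute.one_left _), one_pow, smul_pow]
  obtain ⟨k, hk⟩ := hy.nonempty
  refine ⟨k, sub_eq_zero.mp (hu _ fun m ↦ ?_)⟩
  obtain ⟨l, hl, hml⟩ := hy.exists_gt m
  have hkl : x ^ p ^ k = x ^ p ^ l :=
    congrArg Subtype.val (Eq.trans hk (Eq.symm hl))
  have hle : m ≤ p ^ l := hml.le.trans (Nat.lt_pow_self (Fact.out : p.Prime).one_lt).le
  refine ⟨u ^ (p ^ l - m) • b ^ p ^ l, ?_⟩
  rw [hkl, key, add_sub_cancel_left, smul_smul, ← pow_add, Nat.add_sub_cancel' hle]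

section Field

variable {F : Type*} [Field F]

lemma SL2_pow_char_eq_one_of_mulVec_eq (p : ℕ) [Fact p.Prime] [CharP F p]
    (A : Matrix.SpecialLinearGroup (Fin 2) F) {v : Fin 2 → F} (hv : v ≠ 0)
    (h : (A : Matrix (Fin 2) (Fin 2) F) *ᵥ v = v) :
    A ^ p = 1 := by
  have hd : ((A : Matrix (Fin 2) (Fin 2) F) - 1).det = 0 :=
    exists_mulVec_eq_zero_iff.mp ⟨v, hv, by rw [sub_mulVec, h, one_mulVec, sub_self]⟩
  have hA := A.det_coe
  rw [det_fin_two] at hA hd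
  have h2 : ((A : Matrix (Fin 2) (Fin 2) F) - 1) ^ 2 = 0 := by
    ext i j
    fin_cases i <;> fin_cases j <;>
      simp [sq, Matrix.mul_apply, Fin.sum_univ_two] at hd hA ⊢ <;> grind
  have h3 : ((A : Matrix (Fin 2) (Fin 2) F) - 1) ^ p = 0 :=
    pow_eq_zero_of_le (Fact.out : p.Prime).two_le h2
  rw [sub_pow_char_of_commute _ (Commute.one_right _), one_pow, sub_eq_zero] at h3
  exact Subtype.ext (by simpa using h3)

lemma exists_eq_smul_of_mulVec_eq_zero {C : Matrix (Fin 2) (Fin 2) F} (hC : C ≠ 0)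
    {v w : Fin 2 → F} (hv : v ≠ 0) (hCv : C *ᵥ v = 0) (hCw : C *ᵥ w = 0) :
    ∃ c : F, w = c • v := by
  have hdet : v 0 * w 1 = v 1 * w 0 := by
    by_contra hne
    apply hC
    have e (i : Fin 2) : C i 0 * v 0 + C i 1 * v 1 = 0 := by
      simpa [mulVec, dotProduct, Fin.sum_univ_two] using congrFun hCv i
    have e' (i : Fin 2) : C i 0 * w 0 + C i 1 * w 1 = 0 := by
      simpa [mulVec, dotProduct, Fin.sum_univ_two] using congrFun hCw i
    have hne' : v 0 * w 1 - v 1 * w 0 ≠ 0 := sub_ne_zero.mpr hne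
    ext i j
    refine (mul_eq_zero.mp (?_ : (v 0 * w 1 - v 1 * w 0) * C i j = 0)).resolve_left hne'
    have a := e i
    have b := e' i
    fin_cases j <;> simp only [Fin.zero_eta, Fin.mk_one] <;> grind
  by_cases h0 : v 0 = 0
  · have h1 : v 1 ≠ 0 := fun h1 ↦ hv (by ext i; fin_cases i <;> simp [h0, h1])
    refine ⟨w 1 / v 1, ?_⟩
    ext i; fin_cases i <;> simp <;> field_simp; grind
  · refine ⟨w 0 / v 0, ?_⟩
    ext i; fin_cases i <;> simp <;> field_simp; grind

/-- A finite subgroup of `SL₂(F)` with a nontrivial normal `p`-subgroup, where `p` is the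
characteristic of `F`, stabilises a line. -/
theorem exists_character_of_normal_isPGroup (p : ℕ) [Fact p.Prime] [CharP F p]
    {G : Type*} [Group G] [Finite G] (ρ : G →* Matrix.SpecialLinearGroup (Fin 2) F)
    (hρ : Function.Injective ρ) (N : Subgroup G) [N.Normal] (hN : IsPGroup p N) (hN' : N ≠ ⊥) :
    ∃ v : Fin 2 → F, v ≠ 0 ∧ ∃ χ : G →* F,
      ∀ g, (ρ g : Matrix (Fin 2) (Fin 2) F) *ᵥ v = χ g • v := by
  have : Nontrivial N := (Subgroup.nontrivial_iff_ne_bot N).mpr hN'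
  have := hN.center_nontrivial
  obtain ⟨⟨n, hn⟩, hn1⟩ := exists_ne (1 : Subgroup.center N)
  have hne : (ρ n : Matrix (Fin 2) (Fin 2) F) - 1 ≠ 0 := fun h ↦ hn1 <| by
    have : ρ n = 1 := Subtype.ext (by simpa using sub_eq_zero.mp h)
    rw [map_eq_one_iff ρ hρ] at this
    ext; simpa using this
  have hdet : ((ρ n : Matrix (Fin 2) (Fin 2) F) - 1).det = 0 := by
    obtain ⟨k, hk⟩ := hN n
    have h1 : (ρ n : Matrix (Fin 2) (Fin 2) F) ^ p ^ k = 1 := by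
      rw [← Matrix.SpecialLinearGroup.coe_pow, ← map_pow, ← Subgroup.coe_pow, hk]
      simp
    have h2 : ((ρ n : Matrix (Fin 2) (Fin 2) F) - 1) ^ p ^ k = 0 := by
      rw [sub_pow_char_pow_of_commute _ _ (Commute.one_right _), h1, one_pow, sub_self]
    have h3 := congrArg Matrix.det h2
    rw [det_pow, det_zero] at h3
    exact eq_zero_of_pow_eq_zero h3
  obtain ⟨v, hv, hnv⟩ := exists_mulVec_eq_zero_iff.mpr hdet
  have hnv' : (ρ n : Matrix (Fin 2) (Fin 2) F) *ᵥ v = v := by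
    rwa [sub_mulVec, one_mulVec, sub_eq_zero] at hnv
  have line : ∀ w, (ρ n : Matrix (Fin 2) (Fin 2) F) *ᵥ w = w → ∃ c : F, w = c • v := fun w hw ↦
    exists_eq_smul_of_mulVec_eq_zero hne hv hnv (by rw [sub_mulVec, one_mulVec, hw, sub_self])
  have mul_mulVec : ∀ g h w, (ρ (g * h) : Matrix (Fin 2) (Fin 2) F) *ᵥ w =
      (ρ g : Matrix (Fin 2) (Fin 2) F) *ᵥ ((ρ h : Matrix (Fin 2) (Fin 2) F) *ᵥ w) := fun g h w ↦ by
    rw [mulVec_mulVec, ← Matrix.SpecialLinearGroup.coe_mul, ← map_mul]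
  have hfix : ∀ m ∈ N, (ρ m : Matrix (Fin 2) (Fin 2) F) *ᵥ v = v := fun m hm ↦ by
    have hcomm : (n : G) * m = m * n :=
      (congrArg Subtype.val (Subgroup.mem_center_iff.mp hn ⟨m, hm⟩)).symm
    obtain ⟨c, hc⟩ := line ((ρ m : Matrix (Fin 2) (Fin 2) F) *ᵥ v)
      (by rw [← mul_mulVec, hcomm, mul_mulVec, hnv'])
    have hpow : ∀ i : ℕ, (ρ (m ^ i) : Matrix (Fin 2) (Fin 2) F) *ᵥ v = c ^ i • v := fun i ↦ by
      induction i with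
      | zero => simp
      | succ i ih => rw [pow_succ, mul_mulVec, hc, mulVec_smul, ih, smul_smul, pow_succ, mul_comm]
    obtain ⟨k, hk⟩ := hN ⟨m, hm⟩
    have hk' : m ^ p ^ k = 1 := by simpa using congrArg Subtype.val hk
    have h1 : (c ^ p ^ k - 1) • v = 0 := by
      rw [sub_smul, ← hpow, hk']; simp
    have h2 : (c - 1) ^ p ^ k = 0 := by
      rw [sub_pow_char_pow, one_pow]
      exact (smul_eq_zero.mp h1).resolve_right hv
    rw [hc, sub_eq_zero.mp (eq_zero_of_pow_eq_zero h2), one_smul]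
  have hstable : ∀ g, ∃ c : F, (ρ g : Matrix (Fin 2) (Fin 2) F) *ᵥ v = c • v := fun g ↦ by
    refine line _ ?_
    have hmem : g⁻¹ * n * g ∈ N := by
      simpa using ‹N.Normal›.conj_mem n n.2 g⁻¹
    rw [← mul_mulVec, show (n : G) * g = g * (g⁻¹ * n * g) by group, mul_mulVec, hfix _ hmem]
  choose χ hχ using hstable
  have inj : ∀ {a b : F}, a • v = b • v → a = b := fun h ↦ smul_left_injective F hv h
  refine ⟨v, hv, ⟨⟨χ, inj ?_⟩, fun g h ↦ inj ?_⟩, hχ⟩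
  · rw [← hχ]; simp
  · rw [← hχ, mul_mulVec, hχ, mulVec_smul, hχ, smul_smul, mul_comm]

end Field

section PowerSeries

open PowerSeries

variable {k : Type*} [Field k]

lemma PowerSeries.eq_zero_of_forall_X_pow_dvd {f : k⟦X⟧} (h : ∀ m : ℕ, X ^ m ∣ f) : f = 0 := by
  ext m
  exact X_pow_dvd_iff.mp (h (m + 1)) m m.lt_succ_self

lemma isPGroup_ker_constantCoeff (p : ℕ) [Fact p.Prime] [CharP k p] {n : Type*} [Fintype n]
    [DecidableEq n] [Nonempty n] {G : Type*} [Group G] [Finite G]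
    (φ : G →* Matrix.SpecialLinearGroup n k⟦X⟧) (hφ : Function.Injective φ) :
    IsPGroup p ((Matrix.SpecialLinearGroup.map (constantCoeff (R := k))).comp φ).ker := by
  have : CharP k⟦X⟧ p := charP_of_injective_algebraMap (algebraMap k k⟦X⟧).injective p
  rintro ⟨g, hg⟩
  have hdvd : ∀ i j, X ∣ ((φ g : Matrix n n k⟦X⟧) - 1) i j := fun i j ↦ by
    rw [X_dvd_iff]
    have h := congrArg (fun A : Matrix.SpecialLinearGroup n k ↦ (A : Matrix n n k) i j)
      (MonoidHom.mem_ker.mp hg)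
    have h1 : constantCoeff ((1 : Matrix n n k⟦X⟧) i j) = (1 : Matrix n n k) i j := by
      rw [one_apply, one_apply]; split_ifs <;> simp
    rw [Matrix.sub_apply, map_sub, h1, sub_eq_zero]
    simpa using h
  choose B hB using hdvd
  have hfin : IsOfFinOrder (φ g : Matrix n n k⟦X⟧) := by
    exact ((Matrix.SpecialLinearGroup.coeMonoidHom (ι := n) (R := k⟦X⟧)).comp φ).isOfFinOrder
      (isOfFinOrder_of_finite g)
  obtain ⟨m, hm⟩ := exists_pow_char_pow_eq_one (O := k⟦X⟧) p (u := X) (b := Matrix.of B)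
    (fun c hc ↦ by
      ext1 i j
      refine eq_zero_of_forall_X_pow_dvd fun m ↦ ?_
      obtain ⟨b, rfl⟩ := hc m
      exact ⟨b i j, rfl⟩) hfin
    (by rw [← sub_eq_iff_eq_add']; ext1 i j; exact hB i j)
  refine ⟨m, Subtype.ext (hφ ?_)⟩
  apply Subtype.ext
  simpa using hm

/-- A finite subgroup of `SL₂(k⟦X⟧)`, `k` finite, whose order is divisible by `#k + 1` is mapped
injectively to `SL₂(k)`. -/
theorem map_constantCoeff_comp_injective [Finite k] {G : Type*} [Group G] [Finite G]
    (φ : G →* Matrix.SpecialLinearGroup (Fin 2) k⟦X⟧) (hφ : Function.Injective φ)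
    (hG : Nat.card k + 1 ∣ Nat.card G) :
    Function.Injective
      ((Matrix.SpecialLinearGroup.map (constantCoeff (R := k))).comp φ) := by
  obtain ⟨p, hp⟩ := CharP.exists k
  have : Fact p.Prime := ⟨CharP.char_is_prime k p⟩
  have : CharP k⟦X⟧ p := charP_of_injective_algebraMap (algebraMap k k⟦X⟧).injective p
  have hinj : Function.Injective (algebraMap k⟦X⟧ (LaurentSeries k)) :=
    IsFractionRing.injective _ _
  have : CharP (LaurentSeries k) p := charP_of_injective_algebraMap hinj p
  rw [← MonoidHom.ker_eq_bot_iff]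
  by_contra hN
  let ρ := (Matrix.SpecialLinearGroup.map (n := Fin 2)
    (algebraMap k⟦X⟧ (LaurentSeries k))).comp φ
  have hρ : Function.Injective ρ := fun g h hgh ↦ hφ <| Matrix.SpecialLinearGroup.ext _ _
    fun i j ↦ hinj (congrArg (fun A : Matrix.SpecialLinearGroup (Fin 2) (LaurentSeries k) ↦
      (A : Matrix (Fin 2) (Fin 2) (LaurentSeries k)) i j) hgh)
  obtain ⟨v, hv, χ, hχ⟩ := exists_character_of_normal_isPGroup p ρ hρ _
    (isPGroup_ker_constantCoeff p φ hφ) hN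
  have hint : ∀ g, ∃ f, algebraMap k⟦X⟧ (LaurentSeries k) f = χ g := fun g ↦ by
    rw [← IsIntegrallyClosed.isIntegral_iff]
    refine IsIntegral.of_pow (orderOf_pos g) ?_
    rw [← map_pow, pow_orderOf_eq_one, map_one]
    exact isIntegral_one
  choose ψ hψ using hint
  let Ψ : G →* k⟦X⟧ :=
    ⟨⟨ψ, hinj (by rw [hψ, map_one, map_one])⟩, fun g h ↦ hinj (by
      simp only [hψ, map_mul])⟩
  let θ : G →* kˣ := ((constantCoeff (R := k) : k⟦X⟧ →* k).comp Ψ).toHomUnits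
  have hker : IsPGroup p θ.ker := by
    rintro ⟨g, hg⟩
    have h1 : constantCoeff (ψ g) = 1 := congrArg Units.val (MonoidHom.mem_ker.mp hg)
    obtain ⟨b, hb⟩ : X ∣ ψ g - 1 := by rw [X_dvd_iff, map_sub, h1, map_one, sub_self]
    obtain ⟨m, hm⟩ := exists_pow_char_pow_eq_one (O := k⟦X⟧) (A := k⟦X⟧) p (u := X) (b := b)
      (fun c hc ↦ eq_zero_of_forall_X_pow_dvd hc) (Ψ.isOfFinOrder (isOfFinOrder_of_finite g))
      (sub_eq_iff_eq_add'.mp hb)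
    have hfix : χ (g ^ p ^ m) = 1 := by
      rw [← hψ]
      change algebraMap _ _ (Ψ _) = _
      rw [map_pow, hm, map_one]
    refine ⟨m + 1, Subtype.ext (hρ ?_)⟩
    have := SL2_pow_char_eq_one_of_mulVec_eq p (ρ (g ^ p ^ m)) hv (by rw [hχ, hfix, one_smul])
    rw [← map_pow, ← pow_mul, ← pow_succ] at this
    simpa using this
  obtain ⟨m, hm⟩ := IsPGroup.iff_card.mp hker
  have hcard : Nat.card G = p ^ m * Nat.card θ.range := by
    rw [← hm, ← Subgroup.index_ker, Subgroup.card_mul_index]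
  have hcop : (Nat.card k + 1).Coprime (p ^ m) := by
    have := Fintype.ofFinite k
    have hpk : p ∣ Nat.card k := by
      rw [← CharP.cast_eq_zero_iff k p, Nat.card_eq_fintype_card, FiniteField.cast_card_eq_zero]
    refine Nat.Coprime.pow_right _ (Nat.Coprime.symm ?_)
    rw [Nat.Prime.coprime_iff_not_dvd Fact.out, ← Nat.dvd_add_iff_right hpk, Nat.dvd_one]
    exact (Fact.out : p.Prime).ne_one
  rw [hcard] at hG
  have h1 := Nat.le_of_dvd Nat.card_pos (hcop.dvd_of_dvd_mul_left hG)
  have h2 : Nat.card θ.range ≤ Nat.card kˣ := Nat.card_le_card_of_injective _ Subtype.val_injective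
  have h3 : Nat.card kˣ ≤ Nat.card k := Nat.card_le_card_of_injective _ Units.val_injective
  lia

end PowerSeries

section Center

variable {F : Type*} [Field F]

lemma SL2_center_le_of_even_card (X : Subgroup (Matrix.SpecialLinearGroup (Fin 2) F)) [Finite X]
    (h : (2 : F) ≠ 0 → 2 ∣ Nat.card X) :
    Subgroup.center (Matrix.SpecialLinearGroup (Fin 2) F) ≤ X := by
  have hneg : -1 ∈ X := by
    by_cases h2 : (2 : F) = 0
    · convert X.one_mem
      ext i j
      fin_cases i <;> fin_cases j <;> simp <;> grind
    · have : Fact (Nat.Prime 2) := ⟨Nat.prime_two⟩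
      obtain ⟨g, hg⟩ := exists_prime_orderOf_dvd_card' 2 (h h2)
      have hg1 : (g : Matrix.SpecialLinearGroup (Fin 2) F) ≠ 1 := fun h1 ↦ by
        have : g = 1 := Subtype.ext h1
        simp [this] at hg
      have hg2 : (g : Matrix.SpecialLinearGroup (Fin 2) F) ^ 2 = 1 := by
        simpa [hg] using congrArg Subtype.val (pow_orderOf_eq_one g)
      convert g.2
      generalize (g : Matrix.SpecialLinearGroup (Fin 2) F) = A at hg1 hg2
      have hinv : A = A⁻¹ := eq_inv_of_mul_eq_one_left (by rw [← sq, hg2])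
      have hdet := A.det_coe
      rw [det_fin_two] at hdet
      have e (i j : Fin 2) := congrArg (fun B : Matrix.SpecialLinearGroup (Fin 2) F ↦
        (B : Matrix (Fin 2) (Fin 2) F) i j) hinv
      have e00 := e 0 0
      have e01 := e 0 1
      have e10 := e 1 0
      simp [Matrix.SpecialLinearGroup.coe_inv, adjugate_fin_two] at e00 e01 e10
      have h01 : A 0 1 = 0 := by grind
      have h10 : A 1 0 = 0 := by grind
      have h00 : A 0 0 = 1 ∨ A 0 0 = -1 := by grind
      rcases h00 with h00 | h00
      · refine absurd ?_ hg1
        ext i j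
        fin_cases i <;> fin_cases j <;> simp [h01, h10, h00, ← e00]
      · ext i j
        fin_cases i <;> fin_cases j <;> simp [h01, h10, h00, ← e00]
  intro A hA
  obtain ⟨r, hr, hrA⟩ := Matrix.SpecialLinearGroup.mem_center_iff.mp hA
  rw [Fintype.card_fin, sq_eq_one_iff] at hr
  rcases hr with rfl | rfl
  · convert X.one_mem
    exact Subtype.ext (by simpa using hrA.symm)
  · convert hneg
    exact Subtype.ext (by rw [← hrA, map_neg, map_one, Matrix.SpecialLinearGroup.coe_neg,
      Matrix.SpecialLinearGroup.coe_one])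

end Center


/-- Let `p` be a prime, `q = p^a`, `K = 𝔽_q((u))`, and let `Z` be the
centre of `SL₂(K)`.  If `X` is a finite subgroup of `SL₂(K)` such that `q + 1` divides the
order of the image of `X` in `SL₂(K)/Z`, then `Z ≤ X` and `X` embeds into `SL₂(𝔽_q)`. -/
theorem finite_subgroup_SL2_laurent_embeds (p a : ℕ) [Fact p.Prime] (ha : 1 ≤ a)
    (X : Subgroup (Matrix.SpecialLinearGroup (Fin 2) (LaurentSeries (GaloisField p a))))
    (hfin : Finite X)
    (hdvd : p ^ a + 1 ∣
      Nat.card (X.map (QuotientGroup.mk'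
        (Subgroup.center
          (Matrix.SpecialLinearGroup (Fin 2) (LaurentSeries (GaloisField p a))))))) :
    Subgroup.center (Matrix.SpecialLinearGroup (Fin 2) (LaurentSeries (GaloisField p a))) ≤ X ∧
    ∃ f : X →* Matrix.SpecialLinearGroup (Fin 2) (GaloisField p a),
      Function.Injective f := by
  have hX : p ^ a + 1 ∣ Nat.card X := hdvd.trans (Subgroup.card_map_dvd _ _)
  refine ⟨SL2_center_le_of_even_card X fun h2 ↦ ?_, ?_⟩
  · refine dvd_trans ?_ hX
    have hp : p ≠ 2 := by
      rintro rfl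
      refine h2 ?_
      rw [← map_ofNat (algebraMap (GaloisField 2 a) (LaurentSeries (GaloisField 2 a))) 2]
      have := CharP.cast_eq_zero (GaloisField 2 a) 2
      rw [Nat.cast_ofNat] at this
      rw [this, map_zero]
    have := ((Fact.out : p.Prime).odd_of_ne_two hp).pow (n := a)
    exact (this.add_odd odd_one).two_dvd
  · obtain ⟨φ, hφ⟩ := exists_injective_hom_specialLinearGroup
      (R := PowerSeries (GaloisField p a)) X.subtype X.subtype_injective
    exact ⟨_, map_constantCoeff_comp_injective φ hφ
      (by rwa [GaloisField.card p a (by lia)])⟩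
end

section
/- Let p be a prime, q = p^a, and K = 𝔽_q((u)) equipped with its u-adic valuation topology; give SL₂(K) the subspace topology induced from the entrywise topology on 2×2 matrices over K. If g ∈ SL₂(K) satisfies g^p = 1 and g ≠ 1, then the identity element lies in the closure of the conjugacy class {h g h⁻¹ : h ∈ SL₂(K)}. In particular, this conjugacy class is not closed. -/
/-- `SL₂` over a topological field carries the subspace topology induced from the
entrywise topology on `2 × 2` matrices. -/
noncomputable instance SL2.topologicalSpace (K : Type*) [Field K] [TopologicalSpace K] :
    TopologicalSpace (Matrix.SpecialLinearGroup (Fin 2) K) :=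
  TopologicalSpace.induced
    (fun g => (↑g : Matrix (Fin 2) (Fin 2) K)) inferInstance

/-- A `p`-torsion element of `SL₂` over a field of characteristic `p` is `1 + N` with
`N` of trace and determinant zero. -/
theorem SL2.trace_det_sub_one_eq_zero_of_pow_char_eq_one {K : Type*} [Field K]
    (p : ℕ) [Fact p.Prime]
    [CharP K p] (g : Matrix.SpecialLinearGroup (Fin 2) K) (hgp : g ^ p = 1) :
    (g 0 0 - 1) + (g 1 1 - 1) = 0 ∧ (g 0 0 - 1) * (g 1 1 - 1) - g 0 1 * g 1 0 = 0 := by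
  have hnil : IsNilpotent ((g : Matrix (Fin 2) (Fin 2) K) - 1) := by
    refine ⟨p, ?_⟩
    rw [sub_pow_char_of_commute (p := p) (Commute.one_right _), one_pow,
      ← Matrix.SpecialLinearGroup.coe_pow, hgp, Matrix.SpecialLinearGroup.coe_one, sub_self]
  have ht := (Matrix.isNilpotent_trace_of_isNilpotent hnil).eq_zero
  have hd : ((g : Matrix (Fin 2) (Fin 2) K) - 1).det = 0 := by
    obtain ⟨n, hn⟩ := hnil
    refine eq_zero_of_pow_eq_zero (n := n) ?_
    rw [← Matrix.det_pow, hn, Matrix.det_zero]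
  rw [Matrix.trace_fin_two] at ht
  rw [Matrix.det_fin_two] at hd
  simpa [Matrix.sub_apply] using And.intro ht hd

/-- Conjugation in `SL₂` by a matrix of determinant one, computed on underlying matrices. -/
theorem SL2.exists_coe_conj_eq {K : Type*} [Field K] (g : Matrix.SpecialLinearGroup (Fin 2) K)
    (A : Matrix (Fin 2) (Fin 2) K) (hA : A.det = 1) :
    ∃ h : Matrix.SpecialLinearGroup (Fin 2) K,
      ((h * g * h⁻¹ : Matrix.SpecialLinearGroup (Fin 2) K) : Matrix (Fin 2) (Fin 2) K) =
        A * g * A.adjugate := by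
  let h : Matrix.SpecialLinearGroup (Fin 2) K := ⟨A, hA⟩
  refine ⟨h, ?_⟩
  rw [Matrix.SpecialLinearGroup.coe_mul, Matrix.SpecialLinearGroup.coe_mul,
    Matrix.SpecialLinearGroup.coe_inv]

/-- Over a nondiscrete topological field of characteristic `p`, the identity lies in the closure
of the conjugacy class of every `p`-torsion element of `SL₂`. -/
theorem SL2.one_mem_closure_conjClass {K : Type*} [Field K] [TopologicalSpace K]
    [IsTopologicalRing K] [(nhdsWithin (0 : K) {0}ᶜ).NeBot] (p : ℕ) [Fact p.Prime] [CharP K p]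
    (g : Matrix.SpecialLinearGroup (Fin 2) K) (hgp : g ^ p = 1) :
    (1 : Matrix.SpecialLinearGroup (Fin 2) K) ∈
      closure {x | ∃ h : Matrix.SpecialLinearGroup (Fin 2) K, h * g * h⁻¹ = x} := by
  obtain ⟨htr, hdet⟩ := SL2.trace_det_sub_one_eq_zero_of_pow_char_eq_one p g hgp
  suffices H : ∃ N : Matrix (Fin 2) (Fin 2) K, ∀ t : K, t ≠ 0 →
      ∃ h : Matrix.SpecialLinearGroup (Fin 2) K,
        ((h * g * h⁻¹ : Matrix.SpecialLinearGroup (Fin 2) K) : Matrix (Fin 2) (Fin 2) K) =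
          1 + t ^ 2 • N by
    obtain ⟨N, hN⟩ := H
    refine closure_induced.mpr ?_
    rw [Matrix.SpecialLinearGroup.coe_one]
    have hcont : Continuous fun t : K => (1 : Matrix (Fin 2) (Fin 2) K) + t ^ 2 • N := by
      fun_prop
    have hlim := (hcont.tendsto 0).mono_left (nhdsWithin_le_nhds (s := {0}ᶜ))
    simp only [ne_eq, OfNat.ofNat_ne_zero, not_false_eq_true, zero_pow, zero_smul,
      add_zero] at hlim
    refine mem_closure_of_tendsto hlim ?_
    filter_upwards [self_mem_nhdsWithin] with t ht
    obtain ⟨h, hh⟩ := hN t ht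
    exact ⟨_, ⟨h, rfl⟩, hh⟩
  have h11 : g 1 1 = 2 - g 0 0 := by linear_combination htr
  rw [h11] at hdet
  by_cases hz : g 1 0 = 0
  · have hx : g 0 0 = 1 := by
      have : (g 0 0 - 1) ^ 2 = 0 := by rw [hz] at hdet; linear_combination -hdet
      exact sub_eq_zero.mp (pow_eq_zero_iff two_ne_zero |>.mp this)
    refine ⟨!![0, g 0 1; 0, 0], fun t ht => ?_⟩
    obtain ⟨h, hh⟩ := SL2.exists_coe_conj_eq g !![t, 0; 0, t⁻¹]
      (by simp [Matrix.det_fin_two_of, ht])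
    refine ⟨h, ?_⟩
    rw [hh, Matrix.adjugate_fin_two_of, Matrix.eta_fin_two (g : Matrix (Fin 2) (Fin 2) K),
      h11, hz, hx]
    ext i j
    fin_cases i <;> fin_cases j <;> simp [ht] <;> field_simp
    norm_num
  · refine ⟨!![0, 0; g 1 0, 0], fun t ht => ?_⟩
    obtain ⟨h, hh⟩ := SL2.exists_coe_conj_eq g
      !![t⁻¹, -(t⁻¹ * ((g 0 0 - 1) / g 1 0)); 0, t] (by simp [Matrix.det_fin_two_of, ht])
    refine ⟨h, ?_⟩
    rw [hh, Matrix.adjugate_fin_two_of, Matrix.eta_fin_two (g : Matrix (Fin 2) (Fin 2) K), h11]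
    ext i j
    fin_cases i <;> fin_cases j <;> simp <;> field_simp <;>
      first | ring1 | linear_combination -hdet

/-- The valuation topology on Laurent series is not discrete. -/
theorem LaurentSeries.neBot_nhdsWithin_zero (F : Type*) [Field F] :
    (nhdsWithin (0 : LaurentSeries F) {0}ᶜ).NeBot := by
  rw [← mem_closure_iff_nhdsWithin_neBot, mem_closure_iff_nhds]
  intro s hs
  obtain ⟨γ, hγ⟩ := Valued.mem_nhds_zero.mp hs
  set c := MonoidWithZeroHom.ValueGroup₀.embedding γ.1 with hc
  have hc0 : c ≠ 0 := by simp [hc]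
  obtain ⟨x, hx⟩ := LaurentSeries.valuation_surjective F (WithZero.exp (-1 : ℤ) * c)
  refine ⟨x, hγ ?_, ?_⟩
  · rw [Set.mem_ofPred_eq, Valuation.restrict_lt_iff_lt_embedding, hx]
    exact mul_lt_of_lt_one_left (zero_lt_iff.mpr hc0) (by
      rw [← WithZero.exp_zero, WithZero.exp_lt_exp]; norm_num)
  · rintro rfl
    simp [hc0] at hx

/-- Let `p` be a prime, `q = p^a`, `K = 𝔽_q((u))` with its `u`-adic
valuation topology.  If `g ∈ SL₂(K)` satisfies `g^p = 1` and `g ≠ 1`, then the identity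
lies in the closure of the conjugacy class of `g`; in particular this conjugacy class is
not closed. -/
theorem conjugacy_class_of_p_element_not_closed (p a : ℕ) [Fact p.Prime] (ha : 1 ≤ a)
    (g : Matrix.SpecialLinearGroup (Fin 2) (LaurentSeries (GaloisField p a)))
    (hgp : g ^ p = 1) (hg : g ≠ 1) :
    (1 : Matrix.SpecialLinearGroup (Fin 2) (LaurentSeries (GaloisField p a))) ∈
      closure {x | ∃ h : Matrix.SpecialLinearGroup (Fin 2) (LaurentSeries (GaloisField p a)),
        h * g * h⁻¹ = x} ∧
    ¬ IsClosed {x | ∃ h : Matrix.SpecialLinearGroup (Fin 2) (LaurentSeries (GaloisField p a)),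
        h * g * h⁻¹ = x} := by
  have := LaurentSeries.neBot_nhdsWithin_zero (GaloisField p a)
  have : CharP (LaurentSeries (GaloisField p a)) p :=
    charP_of_injective_algebraMap
      (algebraMap (GaloisField p a) (LaurentSeries (GaloisField p a))).injective p
  have hmem := SL2.one_mem_closure_conjClass p g hgp
  refine ⟨hmem, fun hclosed => hg ?_⟩
  rw [hclosed.closure_eq] at hmem
  obtain ⟨h, hh⟩ := hmem
  exact conj_eq_one_iff.mp hh
end

section
/- Let p be a prime, q = p^a, and K = 𝔽_q((u)) with its u-adic valuation topology, so that SL₂(K) is a topological group. If Γ is a discrete cocompact subgroup of SL₂(K), then Γ contains no element of order p: for every γ ∈ Γ, if γ^p = 1 then γ = 1. -/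
open Filter Topology

/-- A discrete subgroup with compact quotient contains no nontrivial element whose conjugates
accumulate at the identity. -/
theorem Subgroup.eq_one_of_tendsto_conj {G : Type*} [Group G] [TopologicalSpace G]
    [IsTopologicalGroup G] (Γ : Subgroup G) [DiscreteTopology Γ] [CompactSpace (G ⧸ Γ)]
    {ι : Type*} {l : Filter ι} [l.NeBot] {γ : G} (hγ : γ ∈ Γ) (g : ι → G)
    (hg : Tendsto (fun i => g i * γ * (g i)⁻¹) l (𝓝 1)) : γ = 1 := by
  obtain ⟨W, hW, hWΓ⟩ : ∃ W ∈ 𝓝 (1 : G), ∀ x ∈ Γ, x ∈ W → x = 1 := by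
    have h : ({1} : Set Γ) ∈ 𝓝 (1 : Γ) := by simp
    obtain ⟨W, hW, hWs⟩ := (mem_nhds_subtype _ _ _).1 h
    exact ⟨W, hW, fun x hx hxW => congrArg Subtype.val (hWs (a := ⟨x, hx⟩) hxW)⟩
  obtain ⟨c, hc⟩ := exists_clusterPt_of_compactSpace (Filter.map (fun i => (g i : G ⧸ Γ)) l)
  obtain ⟨x, rfl⟩ := QuotientGroup.mk_surjective c
  have hconj : Tendsto (fun y : G × G => y.1⁻¹ * y.2 * y.1) (𝓝 x ×ˢ 𝓝 1) (𝓝 1) := by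
    have h : Continuous (fun y : G × G => y.1⁻¹ * y.2 * y.1) := by fun_prop
    simpa [nhds_prod_eq] using h.tendsto (x, 1)
  obtain ⟨U, hU, V, hV, hUV⟩ := mem_prod_iff.1 (hconj hW)
  have hU' : (QuotientGroup.mk '' U : Set (G ⧸ Γ)) ∈ 𝓝 (x : G ⧸ Γ) :=
    QuotientGroup.isOpenMap_coe.image_mem_nhds hU
  have hfreq : ∃ᶠ i in l, (g i : G ⧸ Γ) ∈ (QuotientGroup.mk '' U : Set (G ⧸ Γ)) :=
    (mapClusterPt_iff_frequently.1 hc) _ hU'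
  obtain ⟨i, ⟨y, hyU, hy⟩, hiV⟩ := (hfreq.and_eventually (hg hV)).exists
  have hδ : y⁻¹ * g i ∈ Γ := QuotientGroup.eq.1 hy
  set δ := y⁻¹ * g i with hδdef
  have hmem : δ * γ * δ⁻¹ ∈ Γ := Γ.mul_mem (Γ.mul_mem hδ hγ) (Γ.inv_mem hδ)
  have hW' : δ * γ * δ⁻¹ ∈ W := by
    have h : y⁻¹ * (g i * γ * (g i)⁻¹) * y ∈ W := hUV (Set.mk_mem_prod hyU hiV)
    simpa [hδdef, mul_assoc] using h
  exact conj_eq_one_iff.1 (hWΓ _ hmem hW')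

namespace Matrix.SpecialLinearGroup

theorem coe_conj {n R : Type*} [DecidableEq n] [Fintype n] [CommRing R]
    (h γ : SpecialLinearGroup n R) :
    (↑(h * γ * h⁻¹) : Matrix n n R) =
      (h : Matrix n n R) * (γ : Matrix n n R) * adjugate (h : Matrix n n R) :=
  rfl

/-- The conjugating element `!![tⁿ, 0; 0, t⁻ⁿ]`. -/
def diagPow {K : Type*} [Field K] (t : Kˣ) (n : ℕ) : SpecialLinearGroup (Fin 2) K :=
  ⟨!![(t : K) ^ n, 0; 0, (t : K)⁻¹ ^ n], by simp [det_fin_two_of]⟩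

theorem coe_diagPow_conj {K : Type*} [Field K] (t : Kˣ) (n : ℕ) {x : K}
    {γ : SpecialLinearGroup (Fin 2) K} (hγ : (γ : Matrix (Fin 2) (Fin 2) K) = !![1, x; 0, 1]) :
    (↑(diagPow t n * γ * (diagPow t n)⁻¹) : Matrix (Fin 2) (Fin 2) K) =
      !![1, (t : K) ^ n * (x * (t : K) ^ n); 0, 1] := by
  rw [coe_conj, hγ]
  change !![(t : K) ^ n, 0; 0, (t : K)⁻¹ ^ n] * _ *
    adjugate !![(t : K) ^ n, 0; 0, (t : K)⁻¹ ^ n] = _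
  simp [adjugate_fin_two_of, mul_assoc]

/-- A unipotent element of `SL₂(K)` is conjugate to an upper triangular one. -/
theorem exists_conj_eq_upper {K : Type*} [Field K] (γ : SpecialLinearGroup (Fin 2) K)
    (hγ : IsNilpotent ((γ : Matrix (Fin 2) (Fin 2) K) - 1)) :
    ∃ (h : SpecialLinearGroup (Fin 2) K) (x : K),
      (↑(h * γ * h⁻¹) : Matrix (Fin 2) (Fin 2) K) = !![1, x; 0, 1] := by
  have htr := (isNilpotent_trace_of_isNilpotent hγ).eq_zero
  have hA := γ.det_coe
  obtain ⟨a, b, c, d, habcd⟩ :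
      ∃ a b c d, (γ : Matrix (Fin 2) (Fin 2) K) = !![a, b; c, d] :=
    ⟨_, _, _, _, eta_fin_two _⟩
  rw [habcd] at htr hA
  simp only [trace_fin_two, sub_apply, of_apply, cons_val', cons_val_zero, cons_val_one,
    one_apply_eq] at htr
  rw [det_fin_two_of] at hA
  obtain rfl : d = 2 - a := by linear_combination htr
  by_cases hc : c = 0
  · subst hc
    obtain rfl : a = 1 := by
      have h : (a - 1) ^ 2 = 0 := by linear_combination -hA
      exact sub_eq_zero.1 (pow_eq_zero_iff two_ne_zero |>.1 h)
    refine ⟨1, b, ?_⟩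
    rw [coe_conj, habcd, coe_one, adjugate_one, one_mul, mul_one]
    norm_num
  · refine ⟨⟨!![0, c⁻¹; -c, a - 1], by simp [det_fin_two_of, hc]⟩, -c⁻¹, ?_⟩
    refine (coe_conj _ _).trans ?_
    simp only [habcd, adjugate_fin_two_of, mul_fin_two]
    ext i j
    fin_cases i <;> fin_cases j <;> simp <;> field_simp <;> grind

/-- Conjugation by `diagPow t n` contracts upper unipotents to the identity. -/
theorem tendsto_diagPow_conj {K : Type*} [Field K] [TopologicalSpace K] [IsTopologicalRing K]
    {t : Kˣ} (ht : IsTopologicallyNilpotent (t : K)) {x : K} {γ : SpecialLinearGroup (Fin 2) K}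
    (hγ : (γ : Matrix (Fin 2) (Fin 2) K) = !![1, x; 0, 1]) :
    Tendsto (fun n => diagPow t n * γ * (diagPow t n)⁻¹) atTop (𝓝 1) := by
  have hind : IsInducing
      (fun g : SpecialLinearGroup (Fin 2) K => (g : Matrix (Fin 2) (Fin 2) K)) := ⟨rfl⟩
  have hlim : Tendsto (fun n : ℕ => (t : K) ^ n * (x * (t : K) ^ n)) atTop (𝓝 0) := by
    simpa using Tendsto.mul ht (ht.const_mul x)
  rw [hind.tendsto_nhds_iff]
  simp only [Function.comp_def, coe_diagPow_conj t _ hγ, coe_one, one_fin_two]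
  refine tendsto_pi_nhds.2 fun i => tendsto_pi_nhds.2 fun j => ?_
  fin_cases i <;> fin_cases j <;> simp [hlim, tendsto_const_nhds]

end Matrix.SpecialLinearGroup

instance SL2.isTopologicalGroup (K : Type*) [Field K] [TopologicalSpace K]
    [IsTopologicalRing K] : IsTopologicalGroup (Matrix.SpecialLinearGroup (Fin 2) K) :=
  Matrix.SpecialLinearGroup.topologicalGroup

open Matrix.SpecialLinearGroup in
/-- A discrete cocompact subgroup of `SL₂(K)` contains no nontrivial unipotent element, as soon as
`K` has a topologically nilpotent unit. -/
theorem SL2.eq_one_of_isNilpotent_sub_one {K : Type*} [Field K] [TopologicalSpace K]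
    [IsTopologicalRing K] {t : Kˣ} (ht : IsTopologicallyNilpotent (t : K))
    (Γ : Subgroup (Matrix.SpecialLinearGroup (Fin 2) K)) [DiscreteTopology Γ]
    [CompactSpace (Matrix.SpecialLinearGroup (Fin 2) K ⧸ Γ)]
    {γ : Matrix.SpecialLinearGroup (Fin 2) K} (hγ : γ ∈ Γ)
    (hnil : IsNilpotent ((γ : Matrix (Fin 2) (Fin 2) K) - 1)) : γ = 1 := by
  obtain ⟨h, x, hx⟩ := exists_conj_eq_upper γ hnil
  refine Γ.eq_one_of_tendsto_conj hγ (l := atTop) (fun n => diagPow t n * h) ?_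
  simpa only [mul_inv_rev, mul_assoc] using tendsto_diagPow_conj ht hx

theorem LaurentSeries.isTopologicallyNilpotent_X (F : Type*) [Field F] :
    IsTopologicallyNilpotent (HahnSeries.single 1 1 : LaurentSeries F) := by
  refine Valued.tendsto_zero_pow_of_v_lt_one ?_
  rw [LaurentSeries.valuation_single_zpow, ← WithZero.exp_zero, WithZero.exp_lt_exp]
  norm_num

/-- Let `p` be a prime, `q = p^a`, `K = 𝔽_q((u))` with its `u`-adic
valuation topology.  If `Γ` is a discrete cocompact subgroup of `SL₂(K)`, then `Γ`
contains no element of order `p`. -/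
theorem cocompact_lattice_has_no_p_elements (p a : ℕ) [Fact p.Prime] (ha : 1 ≤ a)
    (Γ : Subgroup (Matrix.SpecialLinearGroup (Fin 2) (LaurentSeries (GaloisField p a))))
    (hdisc : DiscreteTopology Γ)
    (hcocompact : CompactSpace
      (Matrix.SpecialLinearGroup (Fin 2) (LaurentSeries (GaloisField p a)) ⧸ Γ)) :
    ∀ γ ∈ Γ, γ ^ p = 1 → γ = 1 := by
  intro γ hγ hp
  have : CharP (LaurentSeries (GaloisField p a)) p :=
    charP_of_injective_ringHom (f := (HahnSeries.C : GaloisField p a →+* _))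
      HahnSeries.C_injective p
  let t : (LaurentSeries (GaloisField p a))ˣ :=
    Units.mk0 (HahnSeries.single 1 1) (HahnSeries.single_ne_zero one_ne_zero)
  refine SL2.eq_one_of_isNilpotent_sub_one (t := t)
    (LaurentSeries.isTopologicallyNilpotent_X _) Γ hγ ⟨p, ?_⟩
  rw [sub_pow_char_of_commute _ (Commute.one_right _), one_pow, sub_eq_zero,
    ← Matrix.SpecialLinearGroup.coe_pow, hp, Matrix.SpecialLinearGroup.coe_one]
end

section
/- Let q = 2^a with a ≥ 1 and K = 𝔽_q((u)) with its u-adic valuation topology. Then there exists a subgroup Γ of SL₂(K) which is discrete, cocompact, and isomorphic as a group to the free product of two cyclic groups of order q+1. -/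
namespace Monoid.Coprod

variable {M N α : Type*} [Group M] [Group N]

/-- `Reduced s w` says that `w` is the product of an alternating word in nontrivial elements of
`M` and `N` which is empty or starts with a letter of `M` (if `s = true`) or of `N`
(if `s = false`). -/
inductive Reduced : Bool → Coprod M N → Prop
  | one (s : Bool) : Reduced s 1
  | inl {m : M} {w : Coprod M N} : m ≠ 1 → Reduced false w → Reduced true (inl m * w)
  | inr {n : N} {w : Coprod M N} : n ≠ 1 → Reduced true w → Reduced false (inr n * w)

theorem Reduced.exists_inl_mul (m : M) {s : Bool} {w : Coprod M N} (h : Reduced s w) :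
    ∃ t, Reduced t (Coprod.inl m * w) := by
  by_cases hm : m = 1
  · exact ⟨s, by simpa [hm] using h⟩
  cases h with
  | one s => exact ⟨true, .inl hm (.one false)⟩
  | inr hn hw => exact ⟨true, .inl hm (.inr hn hw)⟩
  | @inl m' w hm' hw =>
    rw [← mul_assoc, ← map_mul]
    by_cases h1 : m * m' = 1
    · exact ⟨false, by simpa [h1] using hw⟩
    · exact ⟨true, .inl h1 hw⟩

theorem Reduced.exists_inr_mul (n : N) {s : Bool} {w : Coprod M N} (h : Reduced s w) :
    ∃ t, Reduced t (Coprod.inr n * w) := by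
  by_cases hn : n = 1
  · exact ⟨s, by simpa [hn] using h⟩
  cases h with
  | one s => exact ⟨false, .inr hn (.one true)⟩
  | inl hm hw => exact ⟨false, .inr hn (.inl hm hw)⟩
  | @inr n' w hn' hw =>
    rw [← mul_assoc, ← map_mul]
    by_cases h1 : n * n' = 1
    · exact ⟨true, by simpa [h1] using hw⟩
    · exact ⟨false, .inr h1 hw⟩

theorem exists_reduced (w : Coprod M N) : ∃ s, Reduced s w := by
  induction w using induction_on' with
  | one => exact ⟨true, .one true⟩
  | inl_mul m w ih => exact ih.choose_spec.exists_inl_mul m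
  | inr_mul n w ih => exact ih.choose_spec.exists_inr_mul n

variable {G β : Type*} [Group G] [MulAction G α] [Preorder β] (f : Coprod M N →* G)
  (X : Bool → Set α) (φ : α → β)

theorem Reduced.eq_one_or_lt
    (hinl : ∀ m ≠ 1, ∀ x ∈ X false, f (Coprod.inl m) • x ∈ X true ∧ φ x < φ (f (Coprod.inl m) • x))
    (hinr : ∀ n ≠ 1, ∀ x ∈ X true, f (Coprod.inr n) • x ∈ X false ∧ φ x < φ (f (Coprod.inr n) • x))
    {s : Bool} {w : Coprod M N} (h : Reduced s w) :
    ∃ t, ∀ x ∈ X t, f w • x ∈ X s ∧ (w = 1 ∨ φ x < φ (f w • x)) := by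
  induction h with
  | one s => exact ⟨s, fun x hx => ⟨by simpa using hx, .inl rfl⟩⟩
  | @inl m w hm hw ih =>
    obtain ⟨t, ht⟩ := ih
    refine ⟨t, fun x hx => ?_⟩
    rw [map_mul, mul_smul]
    obtain ⟨h1, h2⟩ := ht x hx
    obtain ⟨h3, h4⟩ := hinl m hm _ h1
    refine ⟨h3, .inr ?_⟩
    rcases h2 with rfl | h2
    · simpa using h4
    · exact h2.trans h4
  | @inr n w hn hw ih =>
    obtain ⟨t, ht⟩ := ih
    refine ⟨t, fun x hx => ?_⟩
    rw [map_mul, mul_smul]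
    obtain ⟨h1, h2⟩ := ht x hx
    obtain ⟨h3, h4⟩ := hinr n hn _ h1
    refine ⟨h3, .inr ?_⟩
    rcases h2 with rfl | h2
    · simpa using h4
    · exact h2.trans h4

/-- A ping-pong lemma with a potential: if nontrivial elements of the two factors exchange the sets
`X true` and `X false` while increasing `φ`, then a nontrivial element of the free product
increases `φ` somewhere. -/
theorem eq_one_of_forall_le
    (hinl : ∀ m ≠ 1, ∀ x ∈ X false, f (inl m) • x ∈ X true ∧ φ x < φ (f (inl m) • x))
    (hinr : ∀ n ≠ 1, ∀ x ∈ X true, f (inr n) • x ∈ X false ∧ φ x < φ (f (inr n) • x))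
    (hX : ∀ s, (X s).Nonempty) {w : Coprod M N} (hw : ∀ x, φ (f w • x) ≤ φ x) : w = 1 := by
  obtain ⟨s, hs⟩ := exists_reduced w
  obtain ⟨t, ht⟩ := hs.eq_one_or_lt f X φ hinl hinr
  obtain ⟨x, hx⟩ := hX t
  exact (ht x hx).2.resolve_right (hw x).not_gt

end Monoid.Coprod

section Torus

open Matrix

variable {F E : Type*} [Field F] [Field E] [Algebra F E]

theorem norm_coe_ker_unitsMap_norm (z : (Units.map (Algebra.norm F (S := E))).ker) :
    Algebra.norm F ((z : Eˣ) : E) = 1 :=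
  congrArg Units.val (MonoidHom.mem_ker.mp z.2)

theorem natCard_ker_unitsMap_norm [Finite E] (h : Module.finrank F E = 2) :
    Nat.card (Units.map (Algebra.norm F (S := E))).ker = Nat.card F + 1 := by
  have : Finite F := Finite.of_injective _ (algebraMap F E).injective
  have : Module.Finite F E := .of_finite
  have h1 := (Units.map (Algebra.norm F (S := E))).ker.card_mul_index
  rw [Subgroup.index_ker, MonoidHom.range_eq_top.mpr (FiniteField.unitsMap_norm_surjective F E),
    Subgroup.card_top, Nat.card_units, Nat.card_units,
    Module.natCard_eq_pow_finrank (K := F) (V := E), h, ← one_pow 2, Nat.sq_sub_sq, one_pow] at h1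
  exact Nat.eq_of_mul_eq_mul_right (Nat.sub_pos_of_lt Finite.one_lt_card) h1

/-- Elements of norm one of a quadratic extension, as matrices of determinant one. -/
noncomputable def normOneToSL (b : Module.Basis (Fin 2) F E) :
    (Units.map (Algebra.norm F (S := E))).ker →* SpecialLinearGroup (Fin 2) F where
  toFun z := ⟨Algebra.leftMulMatrix b (z : Eˣ), by
    rw [← Algebra.norm_eq_matrix_det]
    exact norm_coe_ker_unitsMap_norm z⟩
  map_one' := by ext1; simp
  map_mul' x y := Subtype.ext (map_mul (Algebra.leftMulMatrix b) _ _)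

variable [CharP F 2] (b : Module.Basis (Fin 2) F E)

theorem normOneToSL_apply_ne_zero {z : (Units.map (Algebra.norm F (S := E))).ker} (hz : z ≠ 1)
    {i j : Fin 2} (hij : i ≠ j) : normOneToSL b z i j ≠ 0 := by
  intro h0
  apply hz
  have : Module.Finite F E := .of_basis b
  have h2 : Module.finrank F E = 2 := by simp [Module.finrank_eq_card_basis b]
  change Algebra.leftMulMatrix b (z : Eˣ) i j = 0 at h0
  rw [Algebra.leftMulMatrix_eq_repr_mul] at h0
  have hc : ((z : Eˣ) : E) * b j = algebraMap F E (b.repr ((z : Eˣ) * b j) j) * b j := by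
    rw [← Algebra.smul_def]
    conv_lhs => rw [← b.sum_repr (((z : Eˣ) : E) * b j)]
    rw [Finset.sum_eq_single j (fun k _ hk => ?_) (by simp)]
    rw [show k = i by omega, h0, zero_smul]
  replace hc := mul_right_cancel₀ (b.ne_zero j) hc
  have hn : Algebra.norm F ((z : Eˣ) : E) = 1 := norm_coe_ker_unitsMap_norm z
  rw [hc, Algebra.norm_algebraMap, h2] at hn
  have h1 := CharTwo.sq_injective (R := F) (hn.trans (one_pow 2).symm)
  ext
  rw [hc, h1]; simp

theorem exists_normOneToSL_mulVec_apply_eq_zero [Finite F] (x : Fin 2 → F) {i j : Fin 2}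
    (hij : i ≠ j) :
    ∃ z, (((normOneToSL b z : SpecialLinearGroup (Fin 2) F) : Matrix _ _ F) *ᵥ x) i = 0 := by
  have : Module.Finite F E := .of_basis b
  have h2 : Module.finrank F E = 2 := by simp [Module.finrank_eq_card_basis b]
  set y := b.equivFun.symm x with hy
  by_cases hy0 : y = 0
  · have : x = 0 := by simpa only [hy, map_eq_zero_iff _ b.equivFun.symm.injective] using hy0
    exact ⟨1, by simp [this]⟩
  have hbj := b.ne_zero j
  obtain ⟨s, hs⟩ := FiniteField.isSquare_of_char_two (ringChar.eq F 2)
    (Algebra.norm F (b j / y))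
  have hs0 : s ≠ 0 := by
    rintro rfl
    simp [hbj, hy0] at hs
  have hsE : algebraMap F E s⁻¹ ≠ 0 := by simpa using hs0
  have hn : Algebra.norm F (b j / y * algebraMap F E s⁻¹) = 1 := by
    rw [map_mul, Algebra.norm_algebraMap, h2, hs]
    field_simp
  have hz0 : b j / y * algebraMap F E s⁻¹ ≠ 0 := mul_ne_zero (div_ne_zero hbj hy0) hsE
  refine ⟨⟨Units.mk0 _ hz0, MonoidHom.mem_ker.mpr (Units.ext hn)⟩, ?_⟩
  have hx : x = b.repr y := by
    rw [← b.equivFun_apply, hy, LinearEquiv.apply_symm_apply]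
  change (Algebra.leftMulMatrix b (b j / y * algebraMap F E s⁻¹) *ᵥ x) i = 0
  rw [hx, Algebra.leftMulMatrix_mulVec_repr,
    show b j / y * algebraMap F E s⁻¹ * y = s⁻¹ • b j by
      rw [Algebra.smul_def, mul_right_comm, div_mul_cancel₀ _ hy0, mul_comm]]
  simp [hij.symm]

/-- The special linear group of a finite field with `q` elements, `q` even, contains a cyclic
group of order `q + 1` whose nontrivial elements fix neither coordinate line, and which is
transitive on lines. -/
theorem exists_nonsplit_torus_char_two (F : Type*) [Field F] [Finite F] [CharP F 2] :
    ∃ ρ : Multiplicative (ZMod (Nat.card F + 1)) →* SpecialLinearGroup (Fin 2) F,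
      (∀ t ≠ 1, ∀ i j, i ≠ j → ρ t i j ≠ 0) ∧
      ∀ (x : Fin 2 → F) (i : Fin 2), ∃ t, ((ρ t : Matrix (Fin 2) (Fin 2) F) *ᵥ x) i = 0 := by
  have h2 := FiniteField.finrank_extension F 2 2
  let b := Module.finBasisOfFinrankEq F (FiniteField.Extension F 2 2) h2
  let e := mulEquivOfCyclicCardEq (G := Multiplicative (ZMod (Nat.card F + 1)))
    (G' := (Units.map (Algebra.norm F (S := FiniteField.Extension F 2 2))).ker)
    (by rw [natCard_ker_unitsMap_norm h2]; simp)
  refine ⟨(normOneToSL b).comp e.toMonoidHom, fun t ht i j hij => ?_, fun x i => ?_⟩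
  · exact normOneToSL_apply_ne_zero b (by simpa using ht) hij
  · obtain ⟨z, hz⟩ := exists_normOneToSL_mulVec_apply_eq_zero b x
      (show i ≠ i + 1 by fin_cases i <;> decide)
    exact ⟨e.symm z, by simpa using hz⟩

end Torus

namespace Matrix.SpecialLinearGroup

section ConjDiag

variable {K : Type*} [Field K]

theorem mul_apply_fin_two (g h : SpecialLinearGroup (Fin 2) K) (i j : Fin 2) :
    (g * h) i j = g i 0 * h 0 j + g i 1 * h 1 j := by
  rw [coe_mul, Matrix.mul_apply, Fin.sum_univ_two]

theorem det_eq_one_fin_two (g : SpecialLinearGroup (Fin 2) K) :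
    g 0 0 * g 1 1 - g 0 1 * g 1 0 = 1 := by
  rw [← det_fin_two, det_coe]

/-- Conjugation by the diagonal matrix with entries `1` and `u`. -/
def conjDiag (u : Kˣ) : SpecialLinearGroup (Fin 2) K →* SpecialLinearGroup (Fin 2) K where
  toFun g := ⟨!![g 0 0, g 0 1 * (u⁻¹ : Kˣ); u * g 1 0, g 1 1], by
    rw [det_fin_two_of]
    linear_combination det_eq_one_fin_two g - (g 0 1 * g 1 0) * u.mul_inv⟩
  map_one' := by
    ext i j
    fin_cases i <;> fin_cases j <;> simp
  map_mul' g h := Subtype.ext <| by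
    change _ = !![g 0 0, g 0 1 * (u⁻¹ : Kˣ); u * g 1 0, g 1 1] *
      !![h 0 0, h 0 1 * (u⁻¹ : Kˣ); u * h 1 0, h 1 1]
    ext i j
    fin_cases i <;> fin_cases j <;> simp [mul_apply_fin_two] <;> field_simp

variable (u : Kˣ) (g : SpecialLinearGroup (Fin 2) K)

@[simp] theorem conjDiag_apply_zero_zero : conjDiag u g 0 0 = g 0 0 := rfl
@[simp] theorem conjDiag_apply_zero_one : conjDiag u g 0 1 = g 0 1 * (u⁻¹ : Kˣ) := rfl
@[simp] theorem conjDiag_apply_one_zero : conjDiag u g 1 0 = u * g 1 0 := rfl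
@[simp] theorem conjDiag_apply_one_one : conjDiag u g 1 1 = g 1 1 := rfl

@[simp] theorem conjDiag_inv_conjDiag : conjDiag u⁻¹ (conjDiag u g) = g := by
  ext i j
  fin_cases i <;> fin_cases j <;> simp

@[simp] theorem conjDiag_conjDiag_inv : conjDiag u (conjDiag u⁻¹ g) = g := by
  simpa using conjDiag_inv_conjDiag u⁻¹ g

/-- The action of the special linear group on column vectors. -/
abbrev mulVecAction : MulAction (SpecialLinearGroup (Fin 2) K) (Fin 2 → K) where
  smul g x := (g : Matrix (Fin 2) (Fin 2) K) *ᵥ x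
  one_smul x := Matrix.one_mulVec x
  mul_smul g h x := (Matrix.mulVec_mulVec x (g : Matrix (Fin 2) (Fin 2) K) h).symm

end ConjDiag

section Integral

variable {K Γ₀ : Type*} [Field K] [LinearOrderedCommGroupWithZero Γ₀] (v : Valuation K Γ₀)

/-- The matrices in `SL₂` with integral entries. -/
def integral : Subgroup (SpecialLinearGroup (Fin 2) K) where
  carrier := {g | ∀ i j, v (g i j) ≤ 1}
  one_mem' i j := by
    by_cases h : i = j <;> simp [h]
  mul_mem' {g h} hg hh i j := by
    rw [mul_apply_fin_two]
    exact v.map_add_le (by simpa using mul_le_one' (hg i 0) (hh 0 j))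
      (by simpa using mul_le_one' (hg i 1) (hh 1 j))
  inv_mem' {g} hg i j := by
    rw [SL2_inv_expl]
    fin_cases i <;> fin_cases j <;> simp [hg _ _]

variable {v} in
theorem mem_integral {g : SpecialLinearGroup (Fin 2) K} :
    g ∈ integral v ↔ ∀ i j, v (g i j) ≤ 1 := Iff.rfl

/-- The Iwahori subgroup relative to `u`. -/
def iwahori (u : Kˣ) : Subgroup (SpecialLinearGroup (Fin 2) K) :=
  integral v ⊓ (integral v).comap (conjDiag u⁻¹)

variable {v} {u : Kˣ}

/-- Integral matrices and their conjugates by a diagonal matrix generate `SL₂`. -/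
theorem integral_sup_comap_conjDiag (hu : ∀ x, ∃ n : ℕ, v (u ^ (2 * n) * x) ≤ 1) :
    integral v ⊔ (integral v).comap (conjDiag u⁻¹) = ⊤ := by
  set H := integral v ⊔ (integral v).comap (conjDiag u⁻¹) with hH
  have h1 : integral v ≤ H := le_sup_left
  have h2 : (integral v).comap (conjDiag u⁻¹) ≤ H := le_sup_right
  let w : SpecialLinearGroup (Fin 2) K := ⟨!![0, 1; -1, 0], by simp⟩
  let w' : SpecialLinearGroup (Fin 2) K := conjDiag u w
  have hw0 : w ∈ integral v := by
    intro i j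
    fin_cases i <;> fin_cases j <;> simp [w]
  have hw : w ∈ H := h1 hw0
  have hw' : w' ∈ H := h2 (by simpa [w'] using hw0)
  let e (x : K) : SpecialLinearGroup (Fin 2) K := ⟨!![1, x; 0, 1], by simp⟩
  have he (n : ℕ) : ∀ x, v (u ^ (2 * n) * x) ≤ 1 → e x ∈ H := by
    induction n with
    | zero =>
      refine fun x hx => h1 fun i j => ?_
      fin_cases i <;> fin_cases j <;> simp [e]
      simpa using hx
    | succ n ih =>
      intro x hx
      have h3 : e x = (w' * w) * e (u ^ 2 * x) * (w' * w)⁻¹ := by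
        rw [eq_mul_inv_iff_mul_eq]
        ext i j
        fin_cases i <;> fin_cases j <;>
          simp only [mul_apply_fin_two, w', conjDiag_apply_zero_zero, conjDiag_apply_zero_one,
            conjDiag_apply_one_zero, conjDiag_apply_one_one, Fin.zero_eta, Fin.mk_one] <;>
          simp [e, w]
        field_simp
      rw [h3]
      have h4 := H.mul_mem hw' hw
      refine H.mul_mem (H.mul_mem h4 (ih _ ?_)) (H.inv_mem h4)
      rwa [← mul_assoc, ← pow_add]
  replace he (x : K) : e x ∈ H := (hu x).elim fun n hn => he n x hn
  let e' (x : K) : SpecialLinearGroup (Fin 2) K := ⟨!![1, 0; x, 1], by simp⟩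
  have he' (x : K) : e' x ∈ H := by
    have h3 : e' x = w * e (-x) * w⁻¹ := by
      rw [eq_mul_inv_iff_mul_eq]
      ext i j
      fin_cases i <;> fin_cases j <;> simp only [mul_apply_fin_two] <;> simp [e, w, e']
    rw [h3]
    exact H.mul_mem (H.mul_mem hw (he _)) (H.inv_mem hw)
  have hne (g : SpecialLinearGroup (Fin 2) K) (hg : g 1 0 ≠ 0) : g ∈ H := by
    have h3 : g = e ((g 0 0 - 1) / g 1 0) * e' (g 1 0) * e ((g 1 1 - 1) / g 1 0) := by
      have hd := det_eq_one_fin_two g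
      ext i j
      fin_cases i <;> fin_cases j <;>
        simp only [mul_apply_fin_two] <;> simp [e, e'] <;> field_simp <;>
        first | done | ring1 | linear_combination -hd
    rw [h3]
    exact H.mul_mem (H.mul_mem (he _) (he' _)) (he _)
  refine eq_top_iff.mpr fun g _ => ?_
  by_cases hg : g 1 0 = 0
  · have hg0 : g 0 0 ≠ 0 := by
      intro h0
      have hd := det_eq_one_fin_two g
      rw [hg, h0] at hd
      simp at hd
    refine (H.mul_mem_cancel_left hw).mp (hne _ ?_)
    rw [mul_apply_fin_two]
    simpa [w] using hg0
  · exact hne g hg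

end Integral

end Matrix.SpecialLinearGroup

namespace LaurentSeries

open WithZero

variable (F : Type*) [Field F]

/-- The uniformizer of the field of Laurent series, as a unit. -/
noncomputable def uniformizer : (LaurentSeries F)ˣ :=
  Units.mk0 (HahnSeries.single (1 : ℤ) (1 : F)) (by simp)

theorem valuation_uniformizer :
    Valued.v (uniformizer F : LaurentSeries F) = (exp (-1) : ℤᵐ⁰) :=
  valuation_single_zpow F 1

variable {F}

theorem valuation_C_le_one (r : F) :
    Valued.v (HahnSeries.C r : LaurentSeries F) ≤ (1 : ℤᵐ⁰) :=
  (val_le_one_iff_eq_coe F _).mpr ⟨PowerSeries.C r, PowerSeries.coe_C r⟩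

theorem valuation_C {r : F} (hr : r ≠ 0) :
    Valued.v (HahnSeries.C r : LaurentSeries F) = (1 : ℤᵐ⁰) := by
  refine le_antisymm (valuation_C_le_one r) ?_
  have h : Valued.v (HahnSeries.C r : LaurentSeries F) *
      Valued.v (HahnSeries.C r⁻¹ : LaurentSeries F) = (1 : ℤᵐ⁰) := by
    rw [← map_mul, ← map_mul, mul_inv_cancel₀ hr, map_one, map_one]
  rw [← h]
  exact mul_le_of_le_one_right' (valuation_C_le_one r⁻¹)

theorem valuation_mul_uniformizer_inv_le_one {f : LaurentSeries F}
    (hf : Valued.v f ≤ (1 : ℤᵐ⁰)) (h0 : f.coeff 0 = 0) :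
    Valued.v (f * ((uniformizer F)⁻¹ : (LaurentSeries F)ˣ)) ≤ (1 : ℤᵐ⁰) := by
  rw [map_mul, Units.val_inv_eq_inv_val, map_inv₀, valuation_uniformizer, ← exp_neg, neg_neg]
  have h : Valued.v f ≤ (exp (-1) : ℤᵐ⁰) := by
    rw [valuation_le_iff_coeff_lt_eq_zero]
    intro n hn
    rcases (Int.le_of_lt_add_one (b := 0) hn).lt_or_eq with hn | rfl
    · exact coeff_zero_of_lt_valuation F (D := 0) (by simpa using hf) hn
    · exact h0
  calc _ ≤ (exp (-1) * exp 1 : ℤᵐ⁰) := by gcongr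
    _ = 1 := by rw [← exp_add]; simp

theorem exists_valuation_uniformizer_pow_mul_le_one (x : LaurentSeries F) :
    ∃ n : ℕ, Valued.v ((uniformizer F : LaurentSeries F) ^ (2 * n) * x) ≤ (1 : ℤᵐ⁰) := by
  by_cases hx : x = 0
  · exact ⟨0, by simp [hx]⟩
  have hv : Valued.v x ≠ (0 : ℤᵐ⁰) := by simpa using hx
  refine ⟨(log (Valued.v x : ℤᵐ⁰)).natAbs, ?_⟩
  rw [map_mul, map_pow, valuation_uniformizer, ← exp_nsmul]
  nth_rw 2 [← exp_log hv]
  rw [← exp_add, ← exp_zero, exp_le_exp]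
  simp only [nsmul_eq_mul]
  push_cast
  have := le_abs_self (log (Valued.v x : ℤᵐ⁰))
  have := abs_nonneg (log (Valued.v x : ℤᵐ⁰))
  linarith

theorem continuous_ofPowerSeries_mk [TopologicalSpace F] [DiscreteTopology F] :
    Continuous fun c : ℕ → F => ((PowerSeries.mk c : PowerSeries F) : LaurentSeries F) := by
  rw [continuous_iff_continuousAt]
  intro c U hU
  obtain ⟨γ, hγ⟩ := Valued.mem_nhds.mp hU
  simp_rw [Valuation.restrict_lt_iff_lt_embedding] at hγ
  set D := -(log (MonoidWithZeroHom.ValueGroup₀.embedding γ.1) - 1) with hD0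
  have hD : exp (-D) < MonoidWithZeroHom.ValueGroup₀.embedding γ.1 := by
    rw [← lt_log_iff_exp_lt (by simp), hD0]
    simp
  have hc : ∀ᶠ c' in nhds c, ∀ n ∈ Finset.range D.toNat, c' n = c n := by
    rw [Filter.eventually_all_finset]
    intro n _
    have h : IsOpen ((fun c' : ℕ → F => c' n) ⁻¹' {c n}) :=
      (isOpen_discrete ({c n} : Set F)).preimage (continuous_apply n)
    exact h.mem_nhds rfl
  refine Filter.mem_map.mpr (hc.mono fun c' hc' => hγ (lt_of_le_of_lt ?_ hD))
  rw [valuation_le_iff_coeff_lt_eq_zero]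
  intro n hn
  rw [HahnSeries.coeff_sub, sub_eq_zero, PowerSeries.coeff_coe, PowerSeries.coeff_coe]
  split_ifs with h
  · rfl
  · rw [PowerSeries.coeff_mk, PowerSeries.coeff_mk]
    exact hc' _ (by rw [Finset.mem_range]; omega)

theorem isCompact_valuation_le_one [Finite F] :
    IsCompact {f : LaurentSeries F | Valued.v f ≤ (1 : ℤᵐ⁰)} := by
  let _ : TopologicalSpace F := ⊥
  have : DiscreteTopology F := ⟨rfl⟩
  convert isCompact_range (continuous_ofPowerSeries_mk (F := F))
  ext f
  rw [Set.mem_ofPred_eq, val_le_one_iff_eq_coe]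
  constructor
  · rintro ⟨p, rfl⟩
    exact ⟨fun n => PowerSeries.coeff n p,
      congrArg _ (PowerSeries.ext fun n => PowerSeries.coeff_mk n _)⟩
  · rintro ⟨c, rfl⟩
    exact ⟨_, rfl⟩

end LaurentSeries

namespace Matrix.SpecialLinearGroup

section PingPong

open WithZero

variable {K : Type*} [Field K] {v : Valuation K ℤᵐ⁰} {u : Kˣ}

/-- The size of a column vector, weighted so that it behaves well under an Iwahori subgroup. -/
def weight (v : Valuation K ℤᵐ⁰) (x : Fin 2 → K) : ℤᵐ⁰ :=
  max (v (x 0) ^ 2) (exp 1 * v (x 1) ^ 2)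

theorem mulVec_apply_fin_two (g : SpecialLinearGroup (Fin 2) K) (x : Fin 2 → K) (i : Fin 2) :
    ((g : Matrix (Fin 2) (Fin 2) K) *ᵥ x) i = g i 0 * x 0 + g i 1 * x 1 := by
  rw [Matrix.mulVec, dotProduct, Fin.sum_univ_two]

theorem one_lt_exp_one : (1 : ℤᵐ⁰) < exp 1 := by
  rw [← exp_zero, exp_lt_exp]
  exact one_pos

theorem weight_lt_of_lt {g : SpecialLinearGroup (Fin 2) K} (hg : g ∈ integral v)
    (hg' : v (g 1 0) = 1) {x : Fin 2 → K} (hx : v (x 1) < v (x 0)) :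
    ((g : Matrix (Fin 2) (Fin 2) K) *ᵥ x) 1 ≠ 0 ∧
      v (((g : Matrix (Fin 2) (Fin 2) K) *ᵥ x) 0) ≤
        v (((g : Matrix (Fin 2) (Fin 2) K) *ᵥ x) 1) ∧
      weight v x < weight v ((g : Matrix (Fin 2) (Fin 2) K) *ᵥ x) := by
  have h0 : 0 < v (x 0) := zero_le.trans_lt hx
  have h1 : v (((g : Matrix (Fin 2) (Fin 2) K) *ᵥ x) 1) = v (x 0) := by
    rw [mulVec_apply_fin_two, v.map_add_eq_of_lt_left, map_mul, hg', one_mul]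
    rw [map_mul, map_mul, hg', one_mul]
    exact (mul_le_of_le_one_left' (hg 1 1)).trans_lt hx
  refine ⟨fun h => ?_, ?_, ?_⟩
  · rw [h, map_zero] at h1
    exact h0.ne h1
  · rw [h1, mulVec_apply_fin_two]
    refine v.map_add_le ?_ ?_ <;> rw [map_mul]
    · exact mul_le_of_le_one_left' (hg 0 0)
    · exact (mul_le_of_le_one_left' (hg 0 1)).trans hx.le
  · refine lt_of_lt_of_le ?_ (le_max_right _ _)
    rw [h1]
    refine max_lt ?_ ?_
    · exact lt_mul_of_one_lt_left (pow_pos h0 2) one_lt_exp_one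
    · have := pow_lt_pow_left₀ hx zero_le two_ne_zero
      exact mul_lt_mul_of_pos_left this (by simp)

theorem weight_lt_of_le {g : SpecialLinearGroup (Fin 2) K} (h00 : v (g 0 0) ≤ 1)
    (h01 : v (g 0 1) = exp 1) (h10 : v (g 1 0) ≤ 1) (h11 : v (g 1 1) ≤ 1) {x : Fin 2 → K}
    (h0 : x 1 ≠ 0) (hx : v (x 0) ≤ v (x 1)) :
    v (((g : Matrix (Fin 2) (Fin 2) K) *ᵥ x) 1) <
        v (((g : Matrix (Fin 2) (Fin 2) K) *ᵥ x) 0) ∧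
      weight v x < weight v ((g : Matrix (Fin 2) (Fin 2) K) *ᵥ x) := by
  replace h0 : 0 < v (x 1) := zero_lt_iff.mpr (by simpa using h0)
  have hlt : v (x 1) < exp 1 * v (x 1) := lt_mul_of_one_lt_left h0 one_lt_exp_one
  have h1 : v (((g : Matrix (Fin 2) (Fin 2) K) *ᵥ x) 0) = exp 1 * v (x 1) := by
    rw [mulVec_apply_fin_two, v.map_add_eq_of_lt_right, map_mul, h01]
    rw [map_mul, map_mul, h01]
    exact ((mul_le_of_le_one_left' h00).trans hx).trans_lt hlt
  constructor
  · rw [h1, mulVec_apply_fin_two]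
    refine (v.map_add_le ?_ ?_).trans_lt hlt <;> rw [map_mul]
    · exact (mul_le_of_le_one_left' h10).trans hx
    · exact mul_le_of_le_one_left' h11
  · refine lt_of_lt_of_le ?_ (le_max_left _ _)
    rw [h1]
    refine max_lt ?_ ?_
    · exact pow_lt_pow_left₀ (hx.trans_lt hlt) zero_le two_ne_zero
    · rw [mul_pow, sq (exp 1), mul_assoc]
      exact lt_mul_of_one_lt_left (mul_pos (by simp) (pow_pos h0 2)) one_lt_exp_one

theorem weight_mulVec_le (hu : v u = exp (-1)) {g : SpecialLinearGroup (Fin 2) K}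
    (hg : g ∈ iwahori v u) (x : Fin 2 → K) :
    weight v ((g : Matrix (Fin 2) (Fin 2) K) *ᵥ x) ≤ weight v x := by
  obtain ⟨h, h'⟩ := hg
  have h10 : exp 1 * v (g 1 0) ≤ 1 := by
    have := h' 1 0
    rwa [conjDiag_apply_one_zero, map_mul, Units.val_inv_eq_inv_val, map_inv₀, hu,
      ← WithZero.exp_neg, neg_neg] at this
  refine max_le ?_ ?_
  · rcases le_max_iff.mp (v.map_add (g 0 0 * x 0) (g 0 1 * x 1)) with h1 | h1 <;>
      rw [← mulVec_apply_fin_two, map_mul] at h1 <;>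
      replace h1 := pow_le_pow_left₀ zero_le (h1.trans (mul_le_of_le_one_left' (h _ _))) 2
    · exact h1.trans (le_max_left _ _)
    · exact (h1.trans (le_mul_of_one_le_left' one_lt_exp_one.le)).trans (le_max_right _ _)
  · rcases le_max_iff.mp (v.map_add (g 1 0 * x 0) (g 1 1 * x 1)) with h1 | h1 <;>
      rw [← mulVec_apply_fin_two, map_mul] at h1
    · refine le_trans ?_ (le_max_left _ _)
      calc exp 1 * v (((g : Matrix (Fin 2) (Fin 2) K) *ᵥ x) 1) ^ 2
          ≤ exp 1 * (v (g 1 0) * v (x 0)) ^ 2 := by gcongr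
        _ = (exp 1 * v (g 1 0)) * v (g 1 0) * v (x 0) ^ 2 := by
          rw [mul_pow, sq (v (g 1 0))]
          simp only [mul_assoc]
        _ ≤ 1 * 1 * v (x 0) ^ 2 := by gcongr; exact h 1 0
        _ = v (x 0) ^ 2 := by simp
    · refine le_trans ?_ (le_max_right _ _)
      gcongr
      exact h1.trans (mul_le_of_le_one_left' (h _ _))

/-- The ping-pong criterion for two subgroups of the two classes of maximal compact subgroups:
the only word which lands in the Iwahori subgroup is the trivial one. -/
theorem eq_one_of_lift_mem_iwahori {M N : Type*} [Group M] [Group N] (hu : v u = exp (-1))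
    {α : M →* SpecialLinearGroup (Fin 2) K} {β : N →* SpecialLinearGroup (Fin 2) K}
    (hα : ∀ t, α t ∈ integral v) (hα' : ∀ t ≠ 1, v (α t 1 0) = 1)
    (hβ : ∀ t, β t ∈ integral v) (hβ' : ∀ t ≠ 1, v (β t 0 1) = 1) {w : Monoid.Coprod M N}
    (hw : Monoid.Coprod.lift α ((conjDiag u).comp β) w ∈ iwahori v u) : w = 1 := by
  let _ : MulAction (SpecialLinearGroup (Fin 2) K) (Fin 2 → K) := mulVecAction
  refine Monoid.Coprod.eq_one_of_forall_le (Monoid.Coprod.lift α ((conjDiag u).comp β))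
    (fun s => cond s {x : Fin 2 → K | x 1 ≠ 0 ∧ v (x 0) ≤ v (x 1)}
      {x | v (x 1) < v (x 0)}) (weight v) ?_ ?_ ?_ (weight_mulVec_le hu hw)
  · intro m hm x hx
    rw [Monoid.Coprod.lift_apply_inl]
    obtain ⟨h1, h2, h3⟩ := weight_lt_of_lt (hα m) (hα' m hm) hx
    exact ⟨⟨h1, h2⟩, h3⟩
  · intro m hm x hx
    rw [Monoid.Coprod.lift_apply_inr]
    obtain ⟨hx0, hx1⟩ : x 1 ≠ 0 ∧ v (x 0) ≤ v (x 1) := hx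
    have hu' : v ((u⁻¹ : Kˣ) : K) = exp 1 := by
      rw [Units.val_inv_eq_inv_val, map_inv₀, hu, ← WithZero.exp_neg, neg_neg]
    have hu1 : v u ≤ 1 := by
      rw [hu, ← exp_zero, exp_le_exp]
      simp
    obtain ⟨h1, h2⟩ := weight_lt_of_le (v := v) (g := conjDiag u (β m)) (hβ m 0 0)
      (by rw [conjDiag_apply_zero_one, map_mul, hβ' m hm, one_mul, hu'])
      (by rw [conjDiag_apply_one_zero, map_mul]; exact mul_le_one' hu1 (hβ m 1 0))
      (hβ m 1 1) hx0 hx1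
    exact ⟨h1, h2⟩
  · rintro (_ | _)
    · exact ⟨![1, 0], by simp⟩
    · exact ⟨![0, 1], by simp⟩

end PingPong

section Reduction

variable {K Γ₀ : Type*} [Field K] [LinearOrderedCommGroupWithZero Γ₀] {v : Valuation K Γ₀}
  {u : Kˣ}

/-- A subgroup containing enough elements to move each of two maximal compact subgroups into
the Iwahori subgroup is transitive modulo the Iwahori subgroup. -/
theorem exists_mul_mem_iwahori (hu : ∀ x, ∃ n : ℕ, v (u ^ (2 * n) * x) ≤ 1)
    (Γ : Subgroup (SpecialLinearGroup (Fin 2) K))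
    (h1 : ∀ k ∈ integral v, ∃ γ ∈ Γ, γ * k ∈ iwahori v u)
    (h2 : ∀ k ∈ (integral v).comap (conjDiag u⁻¹), ∃ γ ∈ Γ, γ * k ∈ iwahori v u)
    (g : SpecialLinearGroup (Fin 2) K) : ∃ γ ∈ Γ, γ * g ∈ iwahori v u := by
  have key : ∀ H : Subgroup (SpecialLinearGroup (Fin 2) K), iwahori v u ≤ H →
      (∀ k ∈ H, ∃ γ ∈ Γ, γ * k ∈ iwahori v u) → ∀ g, ∀ k ∈ H,
      (∃ γ ∈ Γ, γ * g ∈ iwahori v u) → ∃ γ ∈ Γ, γ * (g * k) ∈ iwahori v u := by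
    rintro H hH h g k hk ⟨γ, hγ, hγg⟩
    obtain ⟨δ, hδ, hδg⟩ := h _ (H.mul_mem (hH hγg) hk)
    exact ⟨δ * γ, Γ.mul_mem hδ hγ, by simpa only [mul_assoc] using hδg⟩
  have key1 := key _ inf_le_left h1
  have key2 := key _ inf_le_right h2
  have hg : g ∈ Subgroup.closure ((integral v : Set (SpecialLinearGroup (Fin 2) K)) ∪
      (integral v).comap (conjDiag u⁻¹)) := by
    rw [Subgroup.closure_union, Subgroup.closure_eq, Subgroup.closure_eq,
      integral_sup_comap_conjDiag hu]
    trivial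
  induction hg using Subgroup.closure_induction_right with
  | one => exact ⟨1, Γ.one_mem, by simp⟩
  | mul_right g _ k hk ih =>
    exact hk.elim (fun hk => key1 g k hk ih) (fun hk => key2 g k hk ih)
  | mul_inv_cancel g _ k hk ih =>
    exact hk.elim (fun hk => key1 g _ (inv_mem hk) ih) (fun hk => key2 g _ (inv_mem hk) ih)

end Reduction

end Matrix.SpecialLinearGroup

namespace Matrix.SpecialLinearGroup

open WithZero LaurentSeries

section Topology

variable {F : Type*} [Field F]

theorem continuous_entry (i j : Fin 2) :
    Continuous fun g : SpecialLinearGroup (Fin 2) (LaurentSeries F) => g i j :=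
  (_root_.continuous_apply_apply i j).comp continuous_induced_dom

theorem isCompact_integral [Finite F] :
    IsCompact (integral (Valued.v : Valuation (LaurentSeries F) ℤᵐ⁰) :
      Set (SpecialLinearGroup (Fin 2) (LaurentSeries F))) := by
  have hind : Topology.IsInducing
      fun g : SpecialLinearGroup (Fin 2) (LaurentSeries F) =>
        (g : Matrix (Fin 2) (Fin 2) (LaurentSeries F)) := ⟨rfl⟩
  rw [hind.isCompact_iff]
  have hc : IsCompact {A : Matrix (Fin 2) (Fin 2) (LaurentSeries F) |
      ∀ i j, Valued.v (A i j) ≤ (1 : ℤᵐ⁰)} :=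
    isCompact_pi_infinite fun _ => isCompact_pi_infinite fun _ => isCompact_valuation_le_one
  have hd : IsClosed {A : Matrix (Fin 2) (Fin 2) (LaurentSeries F) | A.det = 1} :=
    isClosed_singleton.preimage (continuous_id.matrix_det)
  convert hc.inter_right hd
  ext A
  constructor
  · rintro ⟨g, hg, rfl⟩
    exact ⟨hg, g.2⟩
  · rintro ⟨hA, hA'⟩
    exact ⟨⟨A, hA'⟩, hA, rfl⟩

theorem isOpen_iwahori (u : (LaurentSeries F)ˣ) :
    IsOpen (iwahori (Valued.v : Valuation (LaurentSeries F) ℤᵐ⁰) u :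
      Set (SpecialLinearGroup (Fin 2) (LaurentSeries F))) := by
  have ho : IsOpen {f : LaurentSeries F | Valued.v f ≤ (1 : ℤᵐ⁰)} :=
    Valued.isOpen_integer (LaurentSeries F)
  have h1 (f : SpecialLinearGroup (Fin 2) (LaurentSeries F) →
        SpecialLinearGroup (Fin 2) (LaurentSeries F)) (hf : ∀ i j, Continuous fun g => f g i j) :
      IsOpen {g | f g ∈ integral (Valued.v : Valuation (LaurentSeries F) ℤᵐ⁰)} := by
    simp only [mem_integral, Set.ofPred_forall]
    exact isOpen_iInter_of_finite fun i => isOpen_iInter_of_finite fun j =>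
      ho.preimage (hf i j)
  refine (h1 id continuous_entry).inter (h1 (conjDiag u⁻¹) fun i j => ?_)
  fin_cases i <;> fin_cases j
  · exact continuous_entry 0 0
  · exact (continuous_entry 0 1).mul continuous_const
  · exact continuous_const.mul (continuous_entry 1 0)
  · exact continuous_entry 1 1

theorem discreteTopology_of_forall_mem_iwahori
    {Γ : Subgroup (SpecialLinearGroup (Fin 2) (LaurentSeries F))} {u : (LaurentSeries F)ˣ}
    (h : ∀ γ ∈ Γ, γ ∈ iwahori (Valued.v : Valuation (LaurentSeries F) ℤᵐ⁰) u → γ = 1) :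
    DiscreteTopology Γ := by
  have : IsTopologicalGroup (SpecialLinearGroup (Fin 2) (LaurentSeries F)) :=
    Matrix.SpecialLinearGroup.topologicalGroup
  refine discreteTopology_of_isOpen_singleton_one ?_
  convert (isOpen_iwahori u).preimage (continuous_subtype_val (p := (· ∈ Γ)))
  ext γ
  constructor
  · rintro rfl
    exact one_mem (iwahori _ u)
  · exact fun hγ => Subtype.ext (h γ γ.2 hγ)

theorem compactSpace_quotient_of_forall_exists_mul_mem_iwahori [Finite F]
    {Γ : Subgroup (SpecialLinearGroup (Fin 2) (LaurentSeries F))} {u : (LaurentSeries F)ˣ}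
    (h : ∀ g, ∃ γ ∈ Γ, γ * g ∈ iwahori (Valued.v : Valuation (LaurentSeries F) ℤᵐ⁰) u) :
    CompactSpace (SpecialLinearGroup (Fin 2) (LaurentSeries F) ⧸ Γ) := by
  have hc : Continuous (QuotientGroup.mk : _ → SpecialLinearGroup (Fin 2) (LaurentSeries F) ⧸ Γ) :=
    continuous_quotient_mk'
  refine ⟨?_⟩
  convert isCompact_integral.image hc
  refine (Set.eq_univ_of_forall fun x => ?_).symm
  induction x using QuotientGroup.induction_on with
  | H g =>
    obtain ⟨γ, hγ, hg⟩ := h g⁻¹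
    refine ⟨(γ * g⁻¹)⁻¹, inv_mem hg.1, QuotientGroup.eq.mpr ?_⟩
    simpa using hγ

end Topology

section Lattice

variable {F : Type*} [Field F]

/-- Constant matrices as matrices over the Laurent series. -/
noncomputable def mapC :
    SpecialLinearGroup (Fin 2) F →* SpecialLinearGroup (Fin 2) (LaurentSeries F) :=
  SpecialLinearGroup.map (HahnSeries.C : F →+* LaurentSeries F)

theorem mapC_apply (g : SpecialLinearGroup (Fin 2) F) (i j : Fin 2) :
    mapC g i j = HahnSeries.C (g i j) := rfl

theorem mapC_mem_integral (g : SpecialLinearGroup (Fin 2) F) :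
    mapC g ∈
      integral (Valued.v : Valuation (LaurentSeries F) ℤᵐ⁰) :=
  fun i j => valuation_C_le_one (g i j)

theorem coeff_zero_mapC_mul (g : SpecialLinearGroup (Fin 2) F)
    (h : SpecialLinearGroup (Fin 2) (LaurentSeries F)) (i j : Fin 2) :
    ((mapC g * h) i j).coeff 0 =
      ((g : Matrix (Fin 2) (Fin 2) F) *ᵥ fun k => (h k j).coeff 0) i := by
  rw [mul_apply_fin_two, mulVec_apply_fin_two, HahnSeries.coeff_add]
  simp [mapC_apply]

/-- Two conjugates of a group which is transitive on lines over the residue field generate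
a subgroup of `SL₂` over the Laurent series which is transitive modulo the Iwahori subgroup. -/
theorem exists_lift_mul_mem_iwahori {M : Type*} [Group M]
    {ρ : M →* SpecialLinearGroup (Fin 2) F}
    (hρ : ∀ x i, ∃ t, ((ρ t : Matrix (Fin 2) (Fin 2) F) *ᵥ x) i = 0)
    (g : SpecialLinearGroup (Fin 2) (LaurentSeries F)) :
    ∃ γ ∈ (Monoid.Coprod.lift (mapC.comp ρ)
      ((conjDiag (uniformizer F)).comp (mapC.comp ρ))).range,
      γ * g ∈ iwahori (Valued.v : Valuation (LaurentSeries F) ℤᵐ⁰) (uniformizer F) := by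
  have hu : Valued.v (uniformizer F : LaurentSeries F) ≤ (1 : ℤᵐ⁰) := by
    rw [valuation_uniformizer, ← exp_zero, exp_le_exp]
    simp
  refine exists_mul_mem_iwahori exists_valuation_uniformizer_pow_mul_le_one _
    (fun k hk => ?_) (fun k hk => ?_) g
  · obtain ⟨t, ht⟩ := hρ (fun i => (k i 0).coeff 0) 1
    rw [← coeff_zero_mapC_mul] at ht
    refine ⟨_, ⟨Monoid.Coprod.inl t, Monoid.Coprod.lift_apply_inl _ _ _⟩, ?_⟩
    have hm := mul_mem (mapC_mem_integral (ρ t)) hk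
    refine ⟨hm, fun i j => ?_⟩
    fin_cases i <;> fin_cases j
    · exact hm 0 0
    · simp only [Fin.zero_eta, Fin.mk_one, conjDiag_apply_zero_one]
      rw [map_mul, inv_inv]
      exact mul_le_one' (hm 0 1) hu
    · simp only [Fin.zero_eta, Fin.mk_one, conjDiag_apply_one_zero]
      rw [mul_comm]
      exact valuation_mul_uniformizer_inv_le_one (hm 1 0) ht
    · exact hm 1 1
  · set h := conjDiag (uniformizer F)⁻¹ k with hh
    obtain ⟨t, ht⟩ := hρ (fun i => (h i 1).coeff 0) 0
    rw [← coeff_zero_mapC_mul] at ht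
    refine ⟨_, ⟨Monoid.Coprod.inr t, Monoid.Coprod.lift_apply_inr _ _ _⟩, ?_⟩
    have hm := mul_mem (mapC_mem_integral (ρ t)) hk
    rw [← conjDiag_conjDiag_inv (uniformizer F) k, ← hh, MonoidHom.comp_apply, ← map_mul]
    refine ⟨fun i j => ?_, ?_⟩
    · fin_cases i <;> fin_cases j
      · exact hm 0 0
      · exact valuation_mul_uniformizer_inv_le_one (hm 0 1) ht
      · simp only [Fin.zero_eta, Fin.mk_one, conjDiag_apply_one_zero]
        rw [map_mul]
        exact mul_le_one' hu (hm 1 0)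
      · exact hm 1 1
    · refine Subgroup.mem_comap.mpr ?_
      rw [conjDiag_inv_conjDiag]
      exact hm

end Lattice

end Matrix.SpecialLinearGroup

open Matrix.SpecialLinearGroup LaurentSeries in
theorem exists_cocompact_lattice_free_product_of_finite (F : Type*) [Field F] [Finite F]
    [CharP F 2] :
    ∃ Γ : Subgroup (Matrix.SpecialLinearGroup (Fin 2) (LaurentSeries F)),
      DiscreteTopology Γ ∧
      CompactSpace (Matrix.SpecialLinearGroup (Fin 2) (LaurentSeries F) ⧸ Γ) ∧
      Nonempty (Γ ≃* Monoid.Coprod (Multiplicative (ZMod (Nat.card F + 1)))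
        (Multiplicative (ZMod (Nat.card F + 1)))) := by
  obtain ⟨ρ, hρ, hρ'⟩ := exists_nonsplit_torus_char_two F
  let f := Monoid.Coprod.lift (mapC.comp ρ) ((conjDiag (uniformizer F)).comp (mapC.comp ρ))
  have hI (w) (hw : f w ∈ iwahori Valued.v (uniformizer F)) : w = 1 := by
    refine eq_one_of_lift_mem_iwahori (valuation_uniformizer F) ?_ ?_ ?_ ?_ hw
    · exact fun t => mapC_mem_integral (ρ t)
    · exact fun t ht => valuation_C (hρ t ht 1 0 one_ne_zero)
    · exact fun t => mapC_mem_integral (ρ t)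
    · exact fun t ht => valuation_C (hρ t ht 0 1 zero_ne_one)
  have hinj : Function.Injective f := (injective_iff_map_eq_one f).mpr fun w hw =>
    hI w (hw ▸ one_mem _)
  refine ⟨f.range, ?_, ?_, ⟨(MonoidHom.ofInjective hinj).symm⟩⟩
  · refine discreteTopology_of_forall_mem_iwahori (u := uniformizer F) ?_
    rintro _ ⟨w, rfl⟩ hw
    rw [hI w hw, map_one]
  · exact compactSpace_quotient_of_forall_exists_mul_mem_iwahori
      (exists_lift_mul_mem_iwahori hρ')

/-- Let `q = 2^a` with `a ≥ 1` and `K = 𝔽_q((u))` with its `u`-adic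
valuation topology.  Then `SL₂(K)` contains a discrete cocompact subgroup isomorphic to
the free product of two cyclic groups of order `q + 1`. -/
theorem exists_cocompact_lattice_free_product_char_two (a : ℕ) (ha : 1 ≤ a) :
    ∃ Γ : Subgroup (Matrix.SpecialLinearGroup (Fin 2) (LaurentSeries (GaloisField 2 a))),
      DiscreteTopology Γ ∧
      CompactSpace
        (Matrix.SpecialLinearGroup (Fin 2) (LaurentSeries (GaloisField 2 a)) ⧸ Γ) ∧
      Nonempty (Γ ≃* Monoid.Coprod (Multiplicative (ZMod (2 ^ a + 1)))
        (Multiplicative (ZMod (2 ^ a + 1)))) := by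
  rw [← GaloisField.card 2 a (Nat.one_le_iff_ne_zero.mp ha)]
  exact exists_cocompact_lattice_free_product_of_finite (GaloisField 2 a)
end
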